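/- For all complex numbers s, z, μ and every nonnegative integer m, the generalized powers on the q-linear lattice satisfy [x_μ(s) − x_μ(z)]^{(m+1)} = [x_{μ−1}(s) − x_{μ−1}(z)]^{(m)} · (x_{μ−m}(s+m) − x_{μ−m}(z)) (equivalently, the quotient [x_μ(s)−x_μ(z)]^{(m+1)} / [x_{μ−1}(s)−x_{μ−1}(z)]^{(m)} equals x_{μ−m}(s+m) − x_{μ−m}(z) whenever the denominator is nonzero). -/

import Mathlib

noncomputable section

/-- `q^w := exp(w · log q)` for a complex exponent `w`. -/
def qp (q : ℝ) (w : ℂ) : ℂ := Complex.exp (w * (Real.log q : ℂ))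

/-- Generalized power `[x_k(s) − x_k(z)]^{(n)}` on the q-linear lattice
`x(s) = c₁·q^s + c₂`. -/
def gp (q : ℝ) (c₁ : ℂ) (n : ℕ) (k s z : ℂ) : ℂ :=
  (-1 : ℂ)^n * c₁^n * qp q (-((n*(n-1) : ℕ) : ℂ)/2) * qp q ((n : ℂ) * (z + k/2)) *
    ∏ j ∈ Finset.range n, (1 - qp q (s - z + (j : ℂ)))

/-- The shifted q-linear lattice `x_k(s) = c₁·q^{s+k/2} + c₂`. -/
def latt (q : ℝ) (c₁ c₂ : ℂ) (k s : ℂ) : ℂ := c₁ * qp q (s + k/2) + c₂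

theorem qp_add (q : ℝ) (a b : ℂ) : qp q (a + b) = qp q a * qp q b := by
  simp only [qp, add_mul, Complex.exp_add]

theorem cast_mul_pred (n : ℕ) : ((n * (n - 1) : ℕ) : ℂ) = n * (n - 1) := by
  cases n <;> simp

/-- Differences of lattice values factor through `1 - q^{s - z + w}`. -/
theorem latt_sub_latt (q : ℝ) (c₁ c₂ k s z w : ℂ) :
    latt q c₁ c₂ k (s + w) - latt q c₁ c₂ k z =
      -c₁ * qp q (z + k / 2) * (1 - qp q (s - z + w)) := by
  have h : s + w + k / 2 = (z + k / 2) + (s - z + w) := by ring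
  rw [latt, latt, h, qp_add]
  ring

/-- The power of `q` in front of the product in `gp` obeys the recurrence. -/
theorem qp_prefactor_succ (q : ℝ) (z μ : ℂ) (m : ℕ) :
    qp q (-(((m + 1) * (m + 1 - 1) : ℕ) : ℂ) / 2) * qp q (((m + 1 : ℕ) : ℂ) * (z + μ / 2)) =
      qp q (-((m * (m - 1) : ℕ) : ℂ) / 2) * qp q ((m : ℂ) * (z + (μ - 1) / 2)) *
        qp q (z + (μ - m) / 2) := by
  simp only [← qp_add, cast_mul_pred]
  congr 1
  push_cast
  ring

theorem stmt4 (q : ℝ) (hq : 0 < q) (hq1 : q ≠ 1) (c₁ c₂ : ℂ) (hc₁ : c₁ ≠ 0)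
    (s z μ : ℂ) (m : ℕ) :
    gp q c₁ (m + 1) μ s z =
      gp q c₁ m (μ - 1) s z *
        (latt q c₁ c₂ (μ - (m : ℂ)) (s + (m : ℂ)) - latt q c₁ c₂ (μ - (m : ℂ)) z) := by
  rw [latt_sub_latt, gp, gp, Finset.prod_range_succ, mul_assoc (_ * _) (qp q _) (qp q _),
    qp_prefactor_succ]
  ring
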